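/- arXiv:1401.1606 — 6 statements merged into one kernel-verified Lean document; each statement's English description precedes it below -/
import Mathlib

section
/- Let F be a field, N ≥ 2, 1 ≤ i ≤ N−1, and let x ∈ F satisfy x ≠ 0 and 1+x ≠ 0. Then, as N×N matrices over F, E_i · H_i(x) · E_i = H_i(1+x) · E_i · H_i(x/(1+x)). -/
/-- `E i` (for `1 ≤ i ≤ N−1`, one-based indexing): the `N × N` identity matrix
with an additional entry `1` in position `(i, i+1)`. -/
def Egen (F : Type*) [Field F] (N : ℕ) (i : ℕ) : Matrix (Fin N) (Fin N) F :=
  Matrix.of fun a b => if a = b then 1 else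
    if (a : ℕ) + 1 = i ∧ (b : ℕ) = i then 1 else 0

/-- `H i x` (one-based indexing): the `N × N` diagonal matrix whose first `i`
diagonal entries equal `x` and whose remaining `N − i` diagonal entries equal `1`. -/
def Hgen (F : Type*) [Field F] (N : ℕ) (i : ℕ) (x : F) : Matrix (Fin N) (Fin N) F :=
  Matrix.diagonal fun a => if (a : ℕ) < i then x else 1

/-- **Relation 6 among the Cartan–Weyl group generators, realized in `GL(N)`:**
`E_i H_i(x) E_i = H_i(1+x) E_i H_i(x/(1+x))`. -/
theorem stmt4 {F : Type*} [Field F] (N : ℕ) (hN : 2 ≤ N) (i : ℕ)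
    (hi1 : 1 ≤ i) (hi2 : i ≤ N - 1) (x : F) (hx : x ≠ 0) (hx1 : 1 + x ≠ 0) :
    Egen F N i * Hgen F N i x * Egen F N i
      = Hgen F N i (1 + x) * Egen F N i * Hgen F N i (x / (1 + x)) := by
  have hp : i - 1 < N := by omega
  have hq : i < N := by omega
  have hE : Egen F N i = 1 + Matrix.single (⟨i - 1, hp⟩ : Fin N) (⟨i, hq⟩ : Fin N) (1 : F) := by
    ext a b
    simp only [Egen, Matrix.of_apply, Matrix.add_apply, Matrix.one_apply, Matrix.single_apply,
      Fin.ext_iff]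
    split_ifs <;> first | omega | simp
  have key : Egen F N i * Hgen F N i x * Egen F N i = Hgen F N i x
      + Matrix.single (⟨i - 1, hp⟩ : Fin N) (⟨i, hq⟩ : Fin N) (1 + x) := by
    have h1 : Matrix.single (⟨i - 1, hp⟩ : Fin N) (⟨i, hq⟩ : Fin N) (1 : F) * Hgen F N i x
        = Matrix.single (⟨i - 1, hp⟩ : Fin N) (⟨i, hq⟩ : Fin N) (1 : F) := by
      ext a b
      simp only [Hgen, Matrix.mul_diagonal, Matrix.single_apply, Fin.ext_iff]
      split_ifs <;> first | omega | simp
    have h2 : Hgen F N i x * Matrix.single (⟨i - 1, hp⟩ : Fin N) (⟨i, hq⟩ : Fin N) (1 : F)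
        = Matrix.single (⟨i - 1, hp⟩ : Fin N) (⟨i, hq⟩ : Fin N) x := by
      ext a b
      simp only [Hgen, Matrix.diagonal_mul, Matrix.single_apply, Fin.ext_iff]
      split_ifs <;> first | omega | simp
    have h3 : Matrix.single (⟨i - 1, hp⟩ : Fin N) (⟨i, hq⟩ : Fin N) (1 : F)
        * Matrix.single (⟨i - 1, hp⟩ : Fin N) (⟨i, hq⟩ : Fin N) (1 : F) = 0 := by
      apply Matrix.single_mul_single_of_ne
      simp only [ne_eq, Fin.ext_iff]
      omega
    rw [hE, add_mul, one_mul, h1, mul_add, mul_one, add_mul, h2, h3, Matrix.single_add]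
    abel
  rw [key]
  ext a b
  simp only [Hgen, Egen, Matrix.mul_diagonal, Matrix.diagonal_mul, Matrix.add_apply,
    Matrix.diagonal_apply, Matrix.single_apply, Matrix.of_apply, Fin.ext_iff]
  split_ifs <;> first | omega | (field_simp <;> simp) | simp
end

section
/- Let F be a field, N ≥ 3, 1 ≤ i ≤ N−2, and let x ∈ F satisfy x ≠ 0 and 1+x ≠ 0. Then, as N×N matrices over F, E_i · H_i(x) · E_{i+1} · E_i = H_i(1+x) · H_{i+1}(x/(1+x)) · E_{i+1} · H_{i+1}(x^{-1}) · E_i · E_{i+1} · H_i(x/(1+x)) · H_{i+1}(1+x). -/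
theorem mul_Egen_aux {F : Type*} [Field F] (N i : ℕ) (hi1 : 1 ≤ i) (h : i < N)
    (M : Matrix (Fin N) (Fin N) F) (a b : Fin N) :
    (M * Egen F N i) a b = M a b + if (b : ℕ) = i then M a ⟨i - 1, by omega⟩ else 0 := by
  have hE : Egen F N i = Matrix.transvection ⟨i - 1, by omega⟩ ⟨i, h⟩ (1 : F) := by
    ext a b
    simp only [Egen, Matrix.transvection, Matrix.of_apply, Matrix.add_apply, Matrix.one_apply,
      Matrix.single_apply, Fin.ext_iff]
    split_ifs <;> first | omega | simp
  rw [hE]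
  by_cases hb : (b : ℕ) = i
  · have : b = ⟨i, h⟩ := Fin.ext hb
    subst this
    simp
  · rw [Matrix.mul_transvection_apply_of_ne _ _ _ _ (by simpa [Fin.ext_iff] using hb)]
    simp [hb]

theorem mul_Hgen_aux {F : Type*} [Field F] (N i : ℕ) (y : F)
    (M : Matrix (Fin N) (Fin N) F) (a b : Fin N) :
    (M * Hgen F N i y) a b = M a b * if (b : ℕ) < i then y else 1 := by
  simp [Hgen, Matrix.mul_diagonal]

set_option maxHeartbeats 4000000 in
/-- **Relation 7 among the Cartan–Weyl group generators (adjacent positive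
simple roots `i` and `i+1`), realized in `GL(N)`:**
`E_i H_i(x) E_{i+1} E_i = H_i(1+x) H_{i+1}(x/(1+x)) E_{i+1} H_{i+1}(x⁻¹) E_i E_{i+1}
  H_i(x/(1+x)) H_{i+1}(1+x)`. -/
theorem stmt5 {F : Type*} [Field F] (N : ℕ) (hN : 3 ≤ N) (i : ℕ)
    (hi1 : 1 ≤ i) (hi2 : i ≤ N - 2) (x : F) (hx : x ≠ 0) (hx1 : 1 + x ≠ 0) :
    Egen F N i * Hgen F N i x * Egen F N (i + 1) * Egen F N i
      = Hgen F N i (1 + x) * Hgen F N (i + 1) (x / (1 + x)) * Egen F N (i + 1)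
        * Hgen F N (i + 1) x⁻¹ * Egen F N i * Egen F N (i + 1)
        * Hgen F N i (x / (1 + x)) * Hgen F N (i + 1) (1 + x) := by
  have h1 : i < N := by omega
  have h2 : i + 1 < N := by omega
  ext a b
  simp only [mul_Egen_aux N i hi1 h1, mul_Egen_aux N (i + 1) (by omega) h2, mul_Hgen_aux]
  simp only [Egen, Hgen, Matrix.of_apply, Matrix.diagonal_apply, Fin.ext_iff]
  obtain ⟨a, ha⟩ := a
  obtain ⟨b, hb⟩ := b
  obtain ⟨k, rfl⟩ : ∃ k, i = k + 1 := ⟨i - 1, by omega⟩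
  simp only [Nat.add_sub_cancel]
  have hab : a = b ∨ a ≠ b := eq_or_ne a b
  have hb3 : b < k ∨ b = k ∨ b = k + 1 ∨ b = k + 2 ∨ k + 2 < b := by omega
  have ha3 : a < k ∨ a = k ∨ a = k + 1 ∨ a = k + 2 ∨ k + 2 < a := by omega
  clear hi2 hi1 hN
  rcases hb3 with hb' | hb' | hb' | hb' | hb' <;>
  simp (disch := omega) only [if_pos, if_neg, and_true, if_true, add_zero, mul_one] <;>
  rcases ha3 with ha' | ha' | ha' | ha' | ha' <;>
  rcases hab with hab | hab <;>
  first
  | (exfalso; omega)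
  | (simp (disch := omega) only [if_pos, if_neg, and_true, if_true, add_zero, zero_add, mul_one, one_mul, zero_mul,
      mul_zero]; done)
  | (simp (disch := omega) only [if_pos, if_neg, and_true, if_true, add_zero, zero_add, mul_one, one_mul, zero_mul,
      mul_zero]; field_simp; done)
  | (simp (disch := omega) only [if_pos, if_neg, and_true, if_true, add_zero, zero_add, mul_one, one_mul, zero_mul,
      mul_zero]; field_simp; ring1)
end

section
/- Let F be a field, N ≥ 2, 1 ≤ i ≤ N−1, and let x ∈ F satisfy x ≠ 0 and 1+x ≠ 0. Then there exists a nonzero scalar c ∈ F such that, as N×N matrices over F, E_{−i} · H_i(x) · E_i = c · P · H_i(x/(1+x)) · E_i · H_i(x^{-1}) · E_{−i} · H_i(x/(1+x)), where P is the product of H_{i−1}(1+x) (included only if i ≥ 2) and H_{i+1}(1+x) (included only if i ≤ N−2). -/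
/-- `E₋ᵢ`: the transpose of `Egen`, i.e. identity with an additional `1` in
position `(i+1, i)` (one-based indexing). -/
def Emgen (F : Type*) [Field F] (N : ℕ) (i : ℕ) : Matrix (Fin N) (Fin N) F :=
  (Egen F N i).transpose

theorem aux_E (F : Type*) [Field F] (N : ℕ) (p q : Fin N) (h : (p : ℕ) + 1 = q) :
    Egen F N (q : ℕ) = 1 + Matrix.single p q 1 := by
  ext a b
  simp only [Egen, Matrix.of_apply, Matrix.add_apply, Matrix.one_apply, Matrix.single_apply,
    Fin.ext_iff]
  split_ifs <;> first | omega | simp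

theorem aux_L {F : Type*} [Field F] {N : ℕ} (p q : Fin N) (d : Fin N → F) :
    (1 + Matrix.single p q (1 : F)).transpose * Matrix.diagonal d * (1 + Matrix.single p q 1)
      = Matrix.diagonal d + Matrix.single q p (d p) + Matrix.single p q (d p)
        + Matrix.single q q (d p) := by
  simp only [Matrix.transpose_add, Matrix.transpose_one, Matrix.transpose_single, add_mul,
    mul_add, one_mul, mul_one]
  ext a b
  simp [Matrix.single_apply, Matrix.mul_apply, Matrix.diagonal_apply, ite_and]
  grind

theorem aux_R {F : Type*} [Field F] {N : ℕ} (p q : Fin N) (d : Fin N → F) :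
    (1 + Matrix.single p q (1 : F)) * Matrix.diagonal d * (1 + Matrix.single p q (1 : F)).transpose
      = Matrix.diagonal d + Matrix.single p q (d q) + Matrix.single q p (d q)
        + Matrix.single p p (d q) := by
  have := aux_L q p d
  simp only [Matrix.transpose_add, Matrix.transpose_one, Matrix.transpose_single] at this ⊢
  exact this

/-- **Relation 9 among the Cartan–Weyl group generators, realized in `PGL(N)`
(i.e. in `GL(N)` up to a nonzero scalar):**
`E_{−i} H_i(x) E_i = c • (P · H_i(x/(1+x)) E_i H_i(x⁻¹) E_{−i} H_i(x/(1+x)))`,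
where `P` includes the factor `H_{i−1}(1+x)` only if `i ≥ 2` and the factor
`H_{i+1}(1+x)` only if `i ≤ N−2`. -/
theorem stmt6 {F : Type*} [Field F] (N : ℕ) (hN : 2 ≤ N) (i : ℕ)
    (hi1 : 1 ≤ i) (hi2 : i ≤ N - 1) (x : F) (hx : x ≠ 0) (hx1 : 1 + x ≠ 0) :
    ∃ c : F, c ≠ 0 ∧
      Emgen F N i * Hgen F N i x * Egen F N i
        = c • ((if 2 ≤ i then Hgen F N (i - 1) (1 + x) else 1)
            * (if i ≤ N - 2 then Hgen F N (i + 1) (1 + x) else 1)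
            * Hgen F N i (x / (1 + x)) * Egen F N i * Hgen F N i x⁻¹
            * Emgen F N i * Hgen F N i (x / (1 + x))) := by
  have hH : ∀ y : F, (if 2 ≤ i then Hgen F N (i - 1) y else 1) = Hgen F N (i - 1) y := by
    intro y
    split_ifs with h
    · rfl
    · have : i - 1 = 0 := by omega
      simp [Hgen, this]
  have hP : (if i ≤ N - 2 then Hgen F N (i + 1) (1 + x) else 1)
      = (if i ≤ N - 2 then (1 : F) else (1 + x)⁻¹) • Hgen F N (i + 1) (1 + x) := by
    split_ifs with h
    · simp
    · ext a b
      have ha : (a : ℕ) < i + 1 := by omega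
      simp only [Hgen, Matrix.smul_apply, Matrix.one_apply, Matrix.diagonal_apply, ha, if_true,
        smul_eq_mul]
      split_ifs <;> simp [hx1]
  have hs : (if i ≤ N - 2 then (1 : F) else (1 + x)⁻¹) ≠ 0 := by
    split_ifs
    · exact one_ne_zero
    · exact inv_ne_zero hx1
  refine ⟨(if i ≤ N - 2 then (1 : F) else (1 + x)⁻¹)⁻¹, inv_ne_zero hs, ?_⟩
  rw [hH, hP]
  simp only [Matrix.smul_mul, Matrix.mul_smul, smul_smul, inv_mul_cancel₀ hs, one_smul]
  clear hH hP hs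
  obtain ⟨p, hp⟩ : ∃ p : Fin N, (p : ℕ) = i - 1 := ⟨⟨i - 1, by omega⟩, rfl⟩
  obtain ⟨q, hq⟩ : ∃ q : Fin N, (q : ℕ) = i := ⟨⟨i, by omega⟩, rfl⟩
  have hE := aux_E F N p q (by omega)
  rw [hq] at hE
  unfold Emgen
  rw [hE]
  unfold Hgen
  rw [aux_L]
  have hassoc : ∀ A B C D E G K : Matrix (Fin N) (Fin N) F,
      A * B * C * D * E * G * K = A * (B * (C * ((D * E * G) * K))) := by
    intros; simp only [Matrix.mul_assoc]
  rw [hassoc, aux_R]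
  ext a b
  simp only [Matrix.diagonal_mul, Matrix.mul_diagonal, Matrix.add_apply, Matrix.single_apply,
    Matrix.diagonal_apply, hp, hq]
  have h1 : i - 1 < i := by omega
  simp only [h1, if_true, lt_irrefl, if_false, Fin.ext_iff, hp, hq]
  by_cases hab : (a : ℕ) = b
  · rw [← hab]
    rcases lt_trichotomy (a : ℕ) i with h | h | h
    · by_cases h' : (a : ℕ) = i - 1
      · have e1 : i ≠ i - 1 := by omega
        simp [h', h1, e1, e1.symm]
        field_simp
      · have e1 : (a : ℕ) < i - 1 := by omega
        have e2 : (a : ℕ) < i + 1 := by omega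
        have e3 : i ≠ a := by omega
        have e4 : i - 1 ≠ a := by omega
        simp [h, e1, e2, e3, e4]
        field_simp
    · have e1 : ¬ (i < i - 1) := by omega
      have e2 : i - 1 ≠ i := by omega
      simp [h, e1, e2]
      try ring
    · have e1 : ¬ ((a : ℕ) < i - 1) := by omega
      have e2 : ¬ ((a : ℕ) < i + 1) := by omega
      have e3 : i ≠ a := by omega
      have e4 : i - 1 ≠ a := by omega
      have e5 : ¬ ((a : ℕ) < i) := by omega
      simp [e1, e2, e3, e4, e5]
  · simp only [hab, if_false]
    by_cases c1 : i = a ∧ i - 1 = b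
    · obtain ⟨ca, cb⟩ := c1
      have e1 : ¬ (i < i - 1) := by omega
      have e2 : i - 1 ≠ i := by omega
      simp [← ca, ← cb, e1, e2, e2.symm, h1]
      try field_simp
    · by_cases c2 : i - 1 = a ∧ i = b
      · obtain ⟨ca, cb⟩ := c2
        have e2 : i - 1 ≠ i := by omega
        have e3 : i - 1 < i + 1 := by omega
        simp [← ca, ← cb, e2, e2.symm, h1, e3]
        try field_simp
      · have c3 : ¬ (i = a ∧ i = b) := by omega
        have c4 : ¬ (i - 1 = a ∧ i - 1 = b) := by omega
        simp [c1, c2, c3, c4]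
end

section
/- Let F be a field and V an F-vector space. Let e : ℤ → V, a, b, α, ã, b̃ : ℤ → F be such that for every i ∈ ℤ: (1) e_{i+3} = a_i(e_i + e_{i+1}) + b_i·e_{i+2}; (2) the vectors ẽ_i := α_i(e_i + e_{i+1}) satisfy ẽ_{i+3} = ã_i(ẽ_i + ẽ_{i+1}) + b̃_i·ẽ_{i+2}; (3) the triple (e_{i+2}, e_{i+3}, e_{i+4}) is linearly independent; (4) a_i ≠ 0, 1 + b_i ≠ 0, and α_i ≠ 0. Then for every i ∈ ℤ: α_i(1+b_i)/a_i = α_{i+1}(1+b_{i+1})/a_{i+1}; moreover ã_i = a_{i+3}(b_{i+1}+1)/(b_{i+3}+1) and b̃_i = b_i(b_{i+1}+1)(b_{i+2}+1)a_{i+3} / ((b_i+1)(b_{i+3}+1)a_{i+2}). -/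
/-- **Derivation of the pentagram map in the coordinates `aᵢ, bᵢ`:** if the
lifted vectors satisfy `e_{i+3} = aᵢ(eᵢ+e_{i+1}) + bᵢ e_{i+2}`, the evolved
vectors `ẽᵢ = αᵢ(eᵢ+e_{i+1})` satisfy `ẽ_{i+3} = ãᵢ(ẽᵢ+ẽ_{i+1}) + b̃ᵢ ẽ_{i+2}`,
each triple `(e_{i+2}, e_{i+3}, e_{i+4})` is linearly independent, and
`aᵢ ≠ 0`, `1+bᵢ ≠ 0`, `αᵢ ≠ 0`, then `αᵢ(1+bᵢ)/aᵢ` is constant in `i` and the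
evolved coefficients are given by the displayed formulas. -/
theorem stmt13 {F : Type*} [Field F] {V : Type*} [AddCommGroup V] [Module F V]
    (e : ℤ → V) (a b α ta tb : ℤ → F)
    (h1 : ∀ i : ℤ, e (i + 3) = a i • (e i + e (i + 1)) + b i • e (i + 2))
    (h2 : ∀ i : ℤ, α (i + 3) • (e (i + 3) + e (i + 4)) =
        ta i • (α i • (e i + e (i + 1)) + α (i + 1) • (e (i + 1) + e (i + 2)))
        + tb i • (α (i + 2) • (e (i + 2) + e (i + 3))))
    (h3 : ∀ i : ℤ, LinearIndependent F ![e (i + 2), e (i + 3), e (i + 4)])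
    (h4 : ∀ i : ℤ, a i ≠ 0) (h5 : ∀ i : ℤ, 1 + b i ≠ 0) (h6 : ∀ i : ℤ, α i ≠ 0) :
    ∀ i : ℤ,
      α i * (1 + b i) / a i = α (i + 1) * (1 + b (i + 1)) / a (i + 1)
      ∧ ta i = a (i + 3) * (b (i + 1) + 1) / (b (i + 3) + 1)
      ∧ tb i = b i * (b (i + 1) + 1) * (b (i + 2) + 1) * a (i + 3)
          / ((b i + 1) * (b (i + 3) + 1) * a (i + 2)) := by
  have key : ∀ i : ℤ, tb i * α (i + 2) = ta i * (α i / a i) * b i ∧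
      α (i + 3) = ta i * (α i / a i - α (i + 1) / a (i + 1) * b (i + 1)) + tb i * α (i + 2) ∧
      α (i + 3) = ta i * (α (i + 1) / a (i + 1)) := by
    intro i
    have e0 : e i + e (i + 1) = (a i)⁻¹ • (e (i + 3) - b i • e (i + 2)) := by
      rw [h1 i, add_sub_cancel_right, smul_smul, inv_mul_cancel₀ (h4 i), one_smul]
    have e1 : e (i + 1) + e (i + 2)
        = (a (i + 1))⁻¹ • (e (i + 4) - b (i + 1) • e (i + 3)) := by
      have h := h1 (i + 1)
      rw [show i + 1 + 3 = i + 4 by ring, show i + 1 + 1 = i + 2 by ring,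
        show i + 1 + 2 = i + 3 by ring] at h
      rw [h, add_sub_cancel_right, smul_smul, inv_mul_cancel₀ (h4 (i + 1)), one_smul]
    have h := h2 i
    rw [e0, e1] at h
    have L := Fintype.linearIndependent_iff.1 (h3 i)
      ![tb i * α (i + 2) - ta i * (α i / a i) * b i,
        ta i * (α i / a i - α (i + 1) / a (i + 1) * b (i + 1)) + tb i * α (i + 2) - α (i + 3),
        ta i * (α (i + 1) / a (i + 1)) - α (i + 3)] (by
        simp only [Fin.sum_univ_three, Matrix.cons_val]
        rw [← sub_eq_zero] at h
        rw [← neg_eq_zero, ← h]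
        simp only [div_eq_mul_inv]
        module)
    have L0 := L 0
    have L1 := L 1
    have L2 := L 2
    simp only [Matrix.cons_val] at L0 L1 L2
    exact ⟨sub_eq_zero.1 L0, (sub_eq_zero.1 L1).symm, (sub_eq_zero.1 L2).symm⟩
  have C : ∀ i : ℤ, α i * (1 + b i) / a i = α (i + 1) * (1 + b (i + 1)) / a (i + 1) := by
    intro i
    obtain ⟨k0, k1, k2⟩ := key i
    have ht : ta i ≠ 0 := by
      intro h
      rw [h, zero_mul] at k2
      exact h6 _ k2
    apply mul_left_cancel₀ ht
    simp only [div_eq_mul_inv] at *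
    linear_combination k2 - k1 - k0
  intro i
  obtain ⟨k0, -, k2⟩ := key i
  have c0 := C i
  have c1 := C (i + 1)
  have c2 := C (i + 2)
  rw [show i + 1 + 1 = i + 2 by ring] at c1
  rw [show i + 2 + 1 = i + 3 by ring] at c2
  refine ⟨c0, ?_⟩
  have A0 := h4 i
  have A1 := h4 (i + 1)
  have A2 := h4 (i + 2)
  have A3 := h4 (i + 3)
  have B0 := h5 i
  have B1 := h5 (i + 1)
  have B2 := h5 (i + 2)
  have B3 := h5 (i + 3)
  have D1 := h6 (i + 1)
  have D2 := h6 (i + 2)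
  have c3 := c1.trans c2
  have c02 := c0.trans c1
  have T : ta i = a (i + 3) * (b (i + 1) + 1) / (b (i + 3) + 1) := by
    rw [add_comm] at B3
    rw [eq_div_iff B3]
    rw [k2] at c3
    field_simp at c3
    linear_combination -c3
  refine ⟨T, ?_⟩
  rw [T] at k0
  rw [add_comm] at B0 B3
  have k : tb i * α (i + 2) * (b i + 1) * (b (i + 3) + 1)
      = a (i + 3) * (b (i + 1) + 1) * b i * (α (i + 2) * (1 + b (i + 2)) / a (i + 2)) := by
    rw [k0, ← c02]
    field_simp
    ring
  rw [eq_div_iff (mul_ne_zero (mul_ne_zero B0 B3) A2)]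
  field_simp at k
  linear_combination k
end

section
/- Let F be a field and a, b : ℤ → F with, for every i ∈ ℤ, a_i ≠ 0, b_i ≠ 0, and 1 + b_i ≠ 0. Define ã_i = a_{i+3}(b_{i+1}+1)/(b_{i+3}+1) and b̃_i = b_i(b_{i+1}+1)(b_{i+2}+1)a_{i+3} / ((b_i+1)(b_{i+3}+1)a_{i+2}); define x_i = b_i/a_i, y_i = −a_{i+1}/(b_i·b_{i+1}), x̃_i = b̃_i/ã_i, ỹ_i = −ã_{i+1}/(b̃_i·b̃_{i+1}). Then for every i ∈ ℤ: x̃_i = x_{i+2}·(1 − x_{i+3}y_{i+2})/(1 − x_{i+1}y_i) and ỹ_i = y_{i+1}·(1 − x_{i+1}y_i)/(1 − x_{i+3}y_{i+2}). -/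
/-- **The pentagram map in Schwartz cross-ratio coordinates:** with
`ãᵢ, b̃ᵢ` given by the pentagram evolution of the coefficients `aᵢ, bᵢ` and
`xᵢ = bᵢ/aᵢ`, `yᵢ = −a_{i+1}/(bᵢ b_{i+1})` (and similarly `x̃ᵢ, ỹᵢ` from
`ãᵢ, b̃ᵢ`), one has `x̃ᵢ = x_{i+2}(1−x_{i+3}y_{i+2})/(1−x_{i+1}yᵢ)` and
`ỹᵢ = y_{i+1}(1−x_{i+1}yᵢ)/(1−x_{i+3}y_{i+2})`. -/
theorem stmt14 {F : Type*} [Field F] (a b : ℤ → F)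
    (ha : ∀ i : ℤ, a i ≠ 0) (hb : ∀ i : ℤ, b i ≠ 0) (hb1 : ∀ i : ℤ, 1 + b i ≠ 0)
    (ta tb x y tx ty : ℤ → F)
    (hta : ∀ i : ℤ, ta i = a (i + 3) * (b (i + 1) + 1) / (b (i + 3) + 1))
    (htb : ∀ i : ℤ, tb i = b i * (b (i + 1) + 1) * (b (i + 2) + 1) * a (i + 3)
        / ((b i + 1) * (b (i + 3) + 1) * a (i + 2)))
    (hx : ∀ i : ℤ, x i = b i / a i)
    (hy : ∀ i : ℤ, y i = - a (i + 1) / (b i * b (i + 1)))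
    (htx : ∀ i : ℤ, tx i = tb i / ta i)
    (hty : ∀ i : ℤ, ty i = - ta (i + 1) / (tb i * tb (i + 1))) :
    ∀ i : ℤ,
      tx i = x (i + 2) * (1 - x (i + 3) * y (i + 2)) / (1 - x (i + 1) * y i)
      ∧ ty i = y (i + 1) * (1 - x (i + 1) * y i) / (1 - x (i + 3) * y (i + 2)) := by
  have hb1' : ∀ i : ℤ, b i + 1 ≠ 0 := fun i => by rw [add_comm]; exact hb1 i
  have key : ∀ i : ℤ, 1 - x (i + 1) * y i = (b i + 1) / b i := by
    intro i
    rw [hx, hy]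
    have h1 := ha (i + 1)
    have h2 := hb (i + 1)
    have h3 := hb i
    field_simp
    ring
  intro i
  have k2 := key (i + 2)
  rw [show i + 2 + 1 = i + 3 by ring] at k2
  rw [k2, key i, htx, hty, hx, hy, htb (i + 1), htb i, hta (i + 1), hta i]
  rw [show i + 1 + 1 = i + 2 by ring, show i + 1 + 2 = i + 3 by ring,
    show i + 1 + 3 = i + 4 by ring]
  have a2 := ha (i + 2)
  have a3 := ha (i + 3)
  have a4 := ha (i + 4)
  have b0 := hb i
  have b1 := hb (i + 1)
  have b2 := hb (i + 2)
  have c0 := hb1' i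
  have c1 := hb1' (i + 1)
  have c2 := hb1' (i + 2)
  have c3 := hb1' (i + 3)
  have c4 := hb1' (i + 4)
  generalize a (i + 2) = A2 at *
  generalize a (i + 3) = A3 at *
  generalize a (i + 4) = A4 at *
  generalize b (i + 1) = B1 at *
  generalize b (i + 2) = B2 at *
  generalize b (i + 3) = B3 at *
  generalize b (i + 4) = B4 at *
  generalize b i = B0 at *
  constructor
  · field_simp
  · field_simp
end

section
/- Let F be a field, N ≥ 1, and let x, y ∈ F be nonzero. Let A, B : ℤ × ℤ → F satisfy: there exist bounds d_A, d_B such that A(I,J) = 0 for |I−J| > d_A and B(I,J) = 0 for |I−J| > d_B; and the quasi-periodicity A(I+N, J+N) = x·A(I,J), B(I+N, J+N) = y·B(I,J) for all I, J. Define the product (A∗B)(I,J) = ∑_{K∈ℤ} A(I,K)·B(K,J) (a finite sum). For a quasi-periodic banded matrix M, define Φ(M) as the N×N matrix over the Laurent polynomial ring F[λ,λ⁻¹] with entries Φ(M)_{ij} = ∑_{K∈ℤ} M(i, j+K·N)·λ^K for i, j ∈ {1,…,N}. Then A∗B is banded and satisfies (A∗B)(I+N,J+N) = xy·(A∗B)(I,J),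 and Φ(A∗B)(λ) = Φ(A)(yλ) · Φ(B)(λ), where Φ(A)(yλ) denotes the matrix obtained from Φ(A) by the substitution λ ↦ yλ in every entry. -/
/-- The loop realization of a quasi-periodic banded `ℤ × ℤ` matrix `M`, with a
scaling parameter `c` for the substitution `λ ↦ cλ`: the `N × N` matrix over
Laurent polynomials with entries `∑_K c^K · M(i, j + K·N) · λ^K`
(for `i, j ∈ {1, …, N}`, one-based indexing). -/
noncomputable def PhiMap {F : Type*} [Field F] (N : ℕ) (c : F) (M : ℤ → ℤ → F) :
    Matrix (Fin N) (Fin N) (LaurentPolynomial F) :=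
  Matrix.of fun i j =>
    ∑ᶠ K : ℤ,
      LaurentPolynomial.C (c ^ K * M ((i : ℤ) + 1) ((j : ℤ) + 1 + K * N))
        * LaurentPolynomial.T K

theorem hBperZ_aux {F : Type*} [Field F] (N : ℕ) (y : F) (hy : y ≠ 0) (B : ℤ → ℤ → F)
    (hBper : ∀ I J : ℤ, B (I + N) (J + N) = y * B I J) (M I J : ℤ) :
    B (I + M * N) (J + M * N) = y ^ M * B I J := by
  induction M using Int.induction_on with
  | zero => simp
  | succ n ih =>
    have := hBper (I + n * N) (J + n * N)
    rw [ih] at this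
    rw [zpow_add_one₀ hy, mul_comm (y ^ (n : ℤ)) y, mul_assoc, ← this]
    congr 1 <;> ring
  | pred n ih =>
    have := hBper (I + (-n - 1) * N) (J + (-n - 1) * N)
    have e : ∀ I : ℤ, I + (-n - 1) * N + N = I + (-n) * N := by intro I; ring
    rw [e, e, ih] at this
    rw [zpow_sub_one₀ hy]
    field_simp
    rw [mul_comm _ y, ← this]

theorem idx_bij_aux (N : ℕ) (hN : 1 ≤ N) :
    Function.Bijective (fun p : Fin N × ℤ × ℤ =>
      ((p.2.1 + p.2.2, (p.1 : ℤ) + 1 + p.2.1 * N) : ℤ × ℤ)) := by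
  haveI : NeZero N := ⟨by omega⟩
  constructor
  · rintro ⟨k, M, L⟩ ⟨k', M', L'⟩ h
    simp only [Prod.mk.injEq] at h
    have h2 := (Int.divModEquiv N).symm.injective (a₁ := (M, k)) (a₂ := (M', k')) (by
      simp only [Int.divModEquiv, Equiv.coe_fn_symm_mk]; linarith [h.2])
    simp only [Prod.mk.injEq] at h2
    obtain ⟨rfl, rfl⟩ := h2
    have : L = L' := by linarith [h.1]
    rw [this]
  · rintro ⟨K, L⟩
    obtain ⟨⟨M, k⟩, h⟩ := (Int.divModEquiv N).symm.surjective (L - 1)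
    simp only [Int.divModEquiv, Equiv.coe_fn_symm_mk] at h
    refine ⟨(k, M, K - M), ?_⟩
    simp only [Prod.mk.injEq]
    constructor <;> linarith

/-- **Correspondence between the infinite-matrix and loop realizations of the
coextended loop group:** the product of two quasi-periodic banded matrices is
quasi-periodic banded with quasi-period `xy`, and
`Φ(A∗B)(λ) = Φ(A)(yλ) · Φ(B)(λ)`. -/
theorem stmt17 {F : Type*} [Field F] (N : ℕ) (hN : 1 ≤ N) (x y : F)
    (hx : x ≠ 0) (hy : y ≠ 0) (A B : ℤ → ℤ → F)
    (hAband : ∃ d : ℕ, ∀ I J : ℤ, (d : ℤ) < |I - J| → A I J = 0)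
    (hBband : ∃ d : ℕ, ∀ I J : ℤ, (d : ℤ) < |I - J| → B I J = 0)
    (hAper : ∀ I J : ℤ, A (I + N) (J + N) = x * A I J)
    (hBper : ∀ I J : ℤ, B (I + N) (J + N) = y * B I J) :
    (∃ d : ℕ, ∀ I J : ℤ, (d : ℤ) < |I - J| → (∑ᶠ K : ℤ, A I K * B K J) = 0)
    ∧ (∀ I J : ℤ, (∑ᶠ K : ℤ, A (I + N) K * B K (J + N))
        = (x * y) * ∑ᶠ K : ℤ, A I K * B K J)
    ∧ PhiMap N (1 : F) (fun I J => ∑ᶠ K : ℤ, A I K * B K J)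
        = PhiMap N y A * PhiMap N (1 : F) B := by
  obtain ⟨dA, hA⟩ := hAband
  obtain ⟨dB, hB⟩ := hBband
  refine ⟨⟨dA + dB, ?_⟩, ?_, ?_⟩
  · intro I J h
    rw [← finsum_zero (α := ℤ) (M := F)]
    congr 1
    ext K
    by_cases h1 : (dA : ℤ) < |I - K|
    · simp [hA I K h1]
    · have h2 : (dB : ℤ) < |K - J| := by
        have := abs_sub_le I K J
        push_cast at h
        linarith
      simp [hB K J h2]
  · intro I J
    rw [mul_finsum, ← finsum_comp_equiv (Equiv.addRight (N : ℤ))]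
    congr 1
    ext K
    simp only [Equiv.coe_addRight, hAper, hBper]
    ring
  · ext1 i j
    rw [Matrix.mul_apply]
    simp only [PhiMap, Matrix.of_apply, one_zpow, one_mul]
    set g : ℤ × ℤ → LaurentPolynomial F := fun p =>
      LaurentPolynomial.C (A ((i : ℤ) + 1) p.2 * B p.2 ((j : ℤ) + 1 + p.1 * N))
        * LaurentPolynomial.T p.1 with hg
    have hAfin : ∀ I : ℤ, (Function.support (A I)).Finite := by
      intro I
      apply (Set.finite_Icc (I - dA) (I + dA)).subset
      intro K hK
      by_contra hc
      apply hK
      apply hA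
      by_contra h
      rw [not_lt, abs_le] at h
      exact hc ⟨by linarith [h.2], by linarith [h.1]⟩
    have hBfin : ∀ K J : ℤ, (Function.support (fun M : ℤ => B K (J + M * N))).Finite := by
      intro K J
      have hf : Set.Finite ((fun M : ℤ => J + M * N) ⁻¹' Set.Icc (K - dB) (K + dB)) := by
        apply (Set.finite_Icc (K - dB) (K + dB)).preimage
        intro a _ b _ hab
        have hN0 : N ≠ 0 := by omega
        simpa [hN0] using hab
      apply hf.subset
      intro M hM
      by_contra hc
      apply hM
      apply hB
      by_contra h
      rw [not_lt, abs_le] at h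
      exact hc ⟨by linarith [h.2], by linarith [h.1]⟩
    have hgfin : (Function.support g).Finite := by
      have : (⋃ L ∈ Function.support (A ((i : ℤ) + 1)), (fun K : ℤ => (K, L)) ''
          Function.support (fun M : ℤ => B L ((j : ℤ) + 1 + M * N))).Finite :=
        (hAfin _).biUnion fun L _ => (hBfin _ _).image _
      apply this.subset
      rintro ⟨K, L⟩ hKL
      simp only [Set.mem_iUnion]
      refine ⟨L, ?_, K, ?_, rfl⟩
      · intro h
        apply hKL
        simp [hg, h]
      · intro h
        apply hKL
        simp only at h
        simp [hg, h]
    have hbij := idx_bij_aux N hN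
    have hL : (∑ᶠ K : ℤ, LaurentPolynomial.C (∑ᶠ L : ℤ, A ((i : ℤ) + 1) L
        * B L ((j : ℤ) + 1 + K * N)) * LaurentPolynomial.T K) = ∑ᶠ p, g p := by
      rw [finsum_curry g hgfin]
      congr 1
      ext1 K
      rw [map_finsum, finsum_mul]
      apply (hAfin ((i : ℤ) + 1)).subset
      intro L hL h
      apply hL
      simp [h]
    rw [hL, ← finsum_comp_equiv (Equiv.ofBijective _ hbij), finsum_curry₃,
      finsum_eq_sum_of_fintype]
    · refine Finset.sum_congr rfl fun k _ => ?_
      rw [finsum_mul]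
      congr 1
      ext1 M
      rw [mul_finsum]
      congr 1
      ext1 L
      simp only [Equiv.ofBijective_apply, hg]
      have := hBperZ_aux N y hy B hBper M ((k : ℤ) + 1) ((j : ℤ) + 1 + L * N)
      have e : (j : ℤ) + 1 + (M + L) * N = (j : ℤ) + 1 + L * N + M * N := by ring
      rw [e, this, LaurentPolynomial.T_add]
      simp only [map_mul]
      ring
    · exact hgfin.preimage (Equiv.injective _).injOn
end
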